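/- arXiv:2011.11623 — 2 statements merged into one kernel-verified Lean document; each statement's English description precedes it below -/
import Mathlib

section
/- Let m ≥ 6 be an integer and r ≥ 7 an integer. Then the equation R_{-2,m}(2cos(π/r), y) = 0 has at least one real solution y > 2. -/
open Real

/-- `α = y² - x² y + 2x² - 2`. -/
noncomputable def chebAlpha (x y : ℝ) : ℝ := y ^ 2 - x ^ 2 * y + 2 * x ^ 2 - 2

/-- `β = 2 + (x² - y - 2)(S_m(α) + (1 - y) S_{m-1}(α))²`. -/
noncomputable def chebBeta (S : ℤ → ℝ → ℝ) (m : ℤ) (x y : ℝ) : ℝ :=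
  2 + (x ^ 2 - y - 2) *
    (S m (chebAlpha x y) + (1 - y) * S (m - 1) (chebAlpha x y)) ^ 2

/-- The Riley polynomial `R_{n,m}(x,y)` of the rational knot `C(2n+1, 2m, 2)`. -/
noncomputable def RileyR (S : ℤ → ℝ → ℝ) (n m : ℤ) (x y : ℝ) : ℝ :=
  ((x ^ 2 - y - 1) * S m (chebAlpha x y) - S (m - 1) (chebAlpha x y)) *
      S n (chebBeta S m x y) -
    ((x ^ 2 - y - 1) * S (m - 1) (chebAlpha x y) - S (m - 2) (chebAlpha x y)) *
      S (n - 1) (chebBeta S m x y)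

open Polynomial in
lemma eq_eval_chebyshev_S {S : ℤ → ℝ → ℝ}
    (hS0 : ∀ z : ℝ, S 0 z = 1) (hS1 : ∀ z : ℝ, S 1 z = z)
    (hSrec : ∀ (k : ℤ) (z : ℝ), S k z = z * S (k - 1) z - S (k - 2) z) (k : ℤ) (z : ℝ) :
    S k z = (Chebyshev.S ℝ k).eval z := by
  induction k using Chebyshev.induct with
  | zero => simp [hS0]
  | one => simp [hS1]
  | add_two n h1 h0 =>
    rw [hSrec, Chebyshev.S_add_two]
    simp only [eval_sub, eval_mul, eval_X]
    rw [← h1, ← h0]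
    ring_nf
  | neg_add_one n h0 h1 =>
    have h := hSrec (-n + 1) z
    rw [Chebyshev.S_sub_one]
    simp only [eval_sub, eval_mul, eval_X]
    rw [← h0, ← h1]
    ring_nf at h ⊢
    linarith

/-- The sequence of Chebyshev polynomials of the second kind `S_k`, evaluated at a real number. -/
noncomputable def chebS (k : ℤ) (z : ℝ) : ℝ := (Polynomial.Chebyshev.S ℝ k).eval z

namespace chebS

lemma zero (z : ℝ) : chebS 0 z = 1 := by simp [chebS]

lemma neg_one (z : ℝ) : chebS (-1) z = 0 := by simp [chebS]

lemma eq_mul_sub (k : ℤ) (z : ℝ) : chebS k z = z * chebS (k - 1) z - chebS (k - 2) z := by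
  simp [chebS, Polynomial.Chebyshev.S_eq ℝ k]

lemma sq_add_sq (k : ℤ) (z : ℝ) :
    chebS k z ^ 2 + chebS (k - 1) z ^ 2 - z * chebS k z * chebS (k - 1) z = 1 := by
  have h := congrArg (Polynomial.eval z) (Polynomial.Chebyshev.S_sq_add_S_sq ℝ (k - 1))
  simp only [sub_add_cancel, Polynomial.eval_sub, Polynomial.eval_add, Polynomial.eval_pow,
    Polynomial.eval_mul, Polynomial.eval_X, Polynomial.eval_one] at h
  unfold chebS
  linarith

@[fun_prop]
lemma continuous (k : ℤ) : Continuous (chebS k) := (Polynomial.Chebyshev.S ℝ k).continuous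

end chebS

lemma monotone_of_rec {z : ℝ} (hz : 2 ≤ z) {g : ℕ → ℝ}
    (hg : ∀ k, g (k + 2) = z * g (k + 1) - g k) (h0 : 0 ≤ g 0) (h1 : g 0 ≤ g 1) :
    Monotone g := by
  have key (k : ℕ) : 0 ≤ g k ∧ g k ≤ g (k + 1) := by
    induction k with
    | zero => exact ⟨h0, h1⟩
    | succ k ih => exact ⟨ih.1.trans ih.2, by rw [hg]; nlinarith⟩
  exact monotone_nat_of_le_succ fun k ↦ (key k).2

lemma one_le_chebS {z : ℝ} (hz : 2 ≤ z) {k : ℤ} (hk : 0 ≤ k) : 1 ≤ chebS k z := by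
  lift k to ℕ using hk
  have h1 : chebS 1 z = z := by simp [chebS]
  have h := monotone_of_rec hz (g := fun n : ℕ ↦ chebS n z)
    (fun n ↦ by push_cast; rw [chebS.eq_mul_sub]; ring_nf)
    (by simp [chebS.zero]) (by simp [chebS.zero, h1]; linarith) k.zero_le
  simpa [chebS.zero] using h

/-- The combination `S_k(z) - (1 + c) S_{k-1}(z)`, whose square enters `β`. -/
noncomputable def chebDiff (c : ℝ) (k : ℤ) (z : ℝ) : ℝ := chebS k z - (1 + c) * chebS (k - 1) z

namespace chebDiff

lemma zero (c z : ℝ) : chebDiff c 0 z = 1 := by simp [chebDiff, chebS.zero, chebS.neg_one]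

lemma one (c z : ℝ) : chebDiff c 1 z = z - (1 + c) := by simp [chebDiff, chebS]

lemma eq_mul_sub (c : ℝ) (k : ℤ) (z : ℝ) :
    chebDiff c k z = z * chebDiff c (k - 1) z - chebDiff c (k - 2) z := by
  unfold chebDiff
  rw [chebS.eq_mul_sub k, chebS.eq_mul_sub (k - 1)]
  ring_nf

lemma monotone_add {c z : ℝ} (hz : 2 ≤ z) (a : ℕ) (h0 : 0 ≤ chebDiff c a z)
    (h1 : chebDiff c a z ≤ chebDiff c (a + 1) z) :
    Monotone fun n : ℕ ↦ chebDiff c (a + n) z :=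
  monotone_of_rec hz
    (fun n ↦ by push_cast; rw [chebDiff.eq_mul_sub]; ring_nf) (by simpa using h0) (by simpa using h1)

lemma one_le {z : ℝ} (hz : 3 ≤ z) {k : ℤ} (hk : 0 ≤ k) : 1 ≤ chebDiff 1 k z := by
  lift k to ℕ using hk
  have h := monotone_add (c := 1) (z := z) (by linarith) 0 (by simp [zero])
    (by simp [zero, one]; linarith) k.zero_le
  simpa [zero] using h

lemma one_lt {c : ℝ} (hc : 0 < c) (hc' : c ≤ 3 / 8) {k : ℤ} (hk : 6 ≤ k) :
    1 < chebDiff c k (2 + c * (3 / 8)) := by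
  set z := 2 + c * (3 / 8) with hz
  have h2 : chebDiff c 2 z = z * chebDiff c 1 z - chebDiff c 0 z := eq_mul_sub c 2 z
  have h3 : chebDiff c 3 z = z * chebDiff c 2 z - chebDiff c 1 z := eq_mul_sub c 3 z
  have h4 : chebDiff c 4 z = z * chebDiff c 3 z - chebDiff c 2 z := eq_mul_sub c 4 z
  have h5 : chebDiff c 5 z = z * chebDiff c 4 z - chebDiff c 3 z := eq_mul_sub c 5 z
  have h6 : chebDiff c 6 z = z * chebDiff c 5 z - chebDiff c 4 z := eq_mul_sub c 6 z
  have pow_le (n : ℕ) : c ^ n * c ≤ (3 / 8) ^ n * c := by gcongr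
  have p1 := pow_le 1
  have p2 := pow_le 2
  have p3 := pow_le 3
  have p4 := pow_le 4
  have p5 := pow_le 5
  rw [zero, one] at h2
  rw [h2, one] at h3
  rw [h3, h2] at h4
  rw [h4, h3] at h5
  rw [h5, h4] at h6
  rw [hz] at h5 h6
  ring_nf at h5 h6 p1 p2 p3 p4 p5
  have h := monotone_add (c := c) (z := z) (by rw [hz]; nlinarith) 5
    (by push_cast; linarith) (by norm_num; linarith)
  obtain ⟨n, rfl⟩ := Int.le.dest hk
  have hn : chebDiff c 6 z ≤ chebDiff c (6 + n) z := by
    have := h (show 1 ≤ 1 + n by lia)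
    simp only at this
    push_cast at this
    rw [← add_assoc] at this
    norm_num at this
    exact this
  linarith

end chebDiff

lemma RileyR_neg_two (m : ℤ) (x y : ℝ) :
    RileyR chebS (-2) m x y =
      chebBeta chebS m x y *
        ((x ^ 2 - y - 1) * chebS (m - 1) (chebAlpha x y) - chebS (m - 2) (chebAlpha x y)) -
      ((x ^ 2 - y - 1) * chebS m (chebAlpha x y) - chebS (m - 1) (chebAlpha x y)) := by
  have h2 (z : ℝ) : chebS (-2) z = -1 := by simp [chebS, Polynomial.Chebyshev.S_neg_two]
  have h3 (z : ℝ) : chebS (-2 - 1) z = -z := by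
    have := chebS.eq_mul_sub (-1) z
    rw [chebS.neg_one] at this
    norm_num [h2] at this ⊢
    linarith
  rw [RileyR, h2, h3]
  ring

/-- With `c = y - 2`, `w = y + 2 - x²`, `a = S_m(α)` and `b = S_{m-1}(α)`, the value of
`R_{-2,m}`. -/
noncomputable def rileyForm (c w a b : ℝ) : ℝ :=
  (2 - w * (a - (1 + c) * b) ^ 2) * ((1 - w) * b - ((2 + c * w) * b - a)) - ((1 - w) * a - b)

lemma RileyR_neg_two_eq_rileyForm (m : ℤ) (x c : ℝ) :
    RileyR chebS (-2) m x (2 + c) =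
      rileyForm c (4 - x ^ 2 + c) (chebS m (2 + c * (4 - x ^ 2 + c)))
        (chebS (m - 1) (2 + c * (4 - x ^ 2 + c))) := by
  have hα : chebAlpha x (2 + c) = 2 + c * (4 - x ^ 2 + c) := by unfold chebAlpha; ring
  rw [RileyR_neg_two, chebBeta, hα, rileyForm]
  have h := chebS.eq_mul_sub m (2 + c * (4 - x ^ 2 + c))
  rw [show chebS (m - 2) (2 + c * (4 - x ^ 2 + c)) = (2 + c * (4 - x ^ 2 + c)) *
    chebS (m - 1) (2 + c * (4 - x ^ 2 + c)) - chebS m (2 + c * (4 - x ^ 2 + c)) by linarith]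
  ring

lemma rileyForm_neg {c w a b : ℝ} (hc : 0 < c) (hcw : c ≤ w) (hw : w < 3 / 8) (hb : 0 < b)
    (hrel : a ^ 2 + b ^ 2 - (2 + c * w) * a * b = 1)
    (hf : w * (a - (1 + c) * b) ^ 2 = 3 / 8) : rileyForm c w a b < 0 := by
  obtain ⟨f, rfl⟩ : ∃ f, a = (1 + c) * b + f := ⟨a - (1 + c) * b, by ring⟩
  obtain ⟨p, hp⟩ : ∃ p, p = w - c + c * w := ⟨_, rfl⟩
  rw [add_sub_cancel_left] at hf
  have hw0 : 0 < w := hc.trans_le hcw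
  have hp0 : 0 < p := by rw [hp]; nlinarith [mul_pos hc hw0]
  have hq : 0 < p * b := mul_pos hp0 hb
  have hf1 : 1 < f ^ 2 := by nlinarith
  have hid : c * ((p * b) * (p * b - (2 - w) * f)) = p * (f ^ 2 - 1) := by
    rw [hp]; linear_combination (-(w - c + c * w)) * hrel
  have hlt : (2 - w) * f < p * b := by
    have h1 : 0 < c * ((p * b) * (p * b - (2 - w) * f)) := by
      rw [hid]; exact mul_pos hp0 (by linarith)
    have h2 := pos_of_mul_pos_right h1 hc.le
    have h3 := pos_of_mul_pos_right h2 hq.le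
    linarith
  have hval : rileyForm c w ((1 + c) * b + f) b = f * (5 / 8 + w) - 5 / 8 * (p * b) := by
    rw [rileyForm, add_sub_cancel_left, hf, hp]; ring
  rw [hval]
  rcases le_or_gt f 0 with h | h <;> nlinarith

lemma rileyForm_pos {w a b : ℝ} (hw : 1 ≤ w) (hb : 0 ≤ b)
    (hd : 0 ≤ (2 + 1 * w) * b - a) (hf : 1 ≤ a - (1 + 1) * b) : 0 < rileyForm 1 w a b := by
  obtain ⟨f, rfl⟩ : ∃ f, a = (1 + 1) * b + f := ⟨a - (1 + 1) * b, by ring⟩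
  rw [add_sub_cancel_left] at hf
  have hval : rileyForm 1 w ((1 + 1) * b + f) b =
      (w * f ^ 2 - 1) * (((2 + 1 * w) * b - ((1 + 1) * b + f)) + (w - 1) * b) + w * f := by
    rw [rileyForm]; ring
  rw [hval]
  have h1 : 0 ≤ w * f ^ 2 - 1 := by nlinarith
  have h2 : 0 ≤ (w - 1) * b := mul_nonneg (by linarith) hb
  have h3 : 0 < w * f := mul_pos (by linarith) (by linarith)
  have := mul_nonneg h1 (add_nonneg hd h2)
  linarith

lemma RileyR_neg_two_three_pos {m : ℤ} (hm : 2 ≤ m) {x : ℝ} (hx : x ^ 2 ≤ 4) :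
    0 < RileyR chebS (-2) m x (2 + 1) := by
  rw [RileyR_neg_two_eq_rileyForm]
  have hz : 3 ≤ 2 + 1 * (4 - x ^ 2 + 1) := by linarith
  have h := chebS.eq_mul_sub m (2 + 1 * (4 - x ^ 2 + 1))
  have hb := one_le_chebS (z := 2 + 1 * (4 - x ^ 2 + 1)) (k := m - 1) (by linarith) (by lia)
  have hd := one_le_chebS (z := 2 + 1 * (4 - x ^ 2 + 1)) (k := m - 2) (by linarith) (by lia)
  exact rileyForm_pos (by linarith) (by linarith) (by linarith)
    (chebDiff.one_le hz (by lia : (0 : ℤ) ≤ m))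

lemma RileyR_neg_two_two (m : ℤ) (x : ℝ) :
    RileyR chebS (-2) m x 2 = 1 - (4 - x ^ 2) * (1 - (4 - x ^ 2)) * m := by
  have h := RileyR_neg_two_eq_rileyForm m x 0
  rw [add_zero] at h
  rw [h]
  simp [rileyForm, chebS, Polynomial.Chebyshev.S_eval_two]
  ring

lemma exists_RileyR_neg_two_neg {m : ℤ} (hm : 6 ≤ m) {x : ℝ} (hx : x ^ 2 ≤ 4)
    (hx' : 4 - x ^ 2 < 3 / 8) :
    ∃ c, 0 < c ∧ c < 1 ∧ RileyR chebS (-2) m x (2 + c) < 0 := by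
  obtain ⟨s, hs⟩ : ∃ s, s = 4 - x ^ 2 := ⟨_, rfl⟩
  rw [← hs] at hx'
  have hs0 : 0 ≤ s := by linarith
  have hcont : ContinuousOn
      (fun c ↦ (s + c) * chebDiff c m (2 + c * (s + c)) ^ 2) (Set.Icc 0 (3 / 8 - s)) := by
    unfold chebDiff
    fun_prop
  have hval0 : (s + 0) * chebDiff 0 m (2 + 0 * (s + 0)) ^ 2 < 3 / 8 := by
    simpa [chebDiff, chebS, Polynomial.Chebyshev.S_eval_two] using hx'
  have hval1 : 3 / 8 < (s + (3 / 8 - s)) *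
      chebDiff (3 / 8 - s) m (2 + (3 / 8 - s) * (s + (3 / 8 - s))) ^ 2 := by
    have h := chebDiff.one_lt (c := 3 / 8 - s) (by linarith) (by linarith) hm
    rw [add_sub_cancel]
    nlinarith
  obtain ⟨c, ⟨hc0, hc1⟩, hc⟩ := intermediate_value_Ioo (by linarith) hcont ⟨hval0, hval1⟩
  refine ⟨c, hc0, by linarith, ?_⟩
  rw [RileyR_neg_two_eq_rileyForm, ← hs]
  have hz : 2 ≤ 2 + c * (s + c) := by
    have := mul_nonneg hc0.le (add_nonneg hs0 hc0.le)
    linarith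
  have hb := one_le_chebS hz (k := m - 1) (by lia)
  exact rileyForm_neg hc0 (by linarith) (by linarith) (by linarith) (chebS.sq_add_sq m _) hc

lemma exists_RileyR_neg_two_root {m : ℤ} (hm : 6 ≤ m) {x : ℝ} (hx : x ^ 2 ≤ 4) (hx' : 3.22 < x ^ 2) :
    ∃ y, 2 < y ∧ RileyR chebS (-2) m x y = 0 := by
  obtain ⟨c, hc0, hc1, hc⟩ : ∃ c, 0 ≤ c ∧ c < 1 ∧ RileyR chebS (-2) m x (2 + c) < 0 := by
    rcases lt_or_ge (4 - x ^ 2) (3 / 8) with h | h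
    · obtain ⟨c, hc0, hc⟩ := exists_RileyR_neg_two_neg hm hx h
      exact ⟨c, hc0.le, hc⟩
    · refine ⟨0, le_rfl, one_pos, ?_⟩
      rw [add_zero, RileyR_neg_two_two]
      have hm' : (6 : ℝ) ≤ m := by exact_mod_cast hm
      have hs : 1 / 6 < (4 - x ^ 2) * (1 - (4 - x ^ 2)) := by nlinarith
      nlinarith
  have hcont : ContinuousOn (RileyR chebS (-2) m x) (Set.Icc (2 + c) (2 + 1)) := by
    have : Continuous (RileyR chebS (-2) m x) := by
      unfold RileyR chebBeta chebAlpha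
      fun_prop
    exact this.continuousOn
  obtain ⟨y, hy, hy0⟩ := intermediate_value_Ioo (by linarith) hcont
    ⟨hc, RileyR_neg_two_three_pos (by lia) hx⟩
  exact ⟨y, by linarith [hy.1], hy0⟩

lemma lt_sq_two_mul_cos_pi_div {r : ℕ} (hr : 7 ≤ r) : 3.22 < (2 * cos (π / r)) ^ 2 := by
  have hr' : (7 : ℝ) ≤ r := by exact_mod_cast hr
  have hle : π / r ≤ 0.45 := by
    rw [div_le_iff₀ (by linarith)]
    linarith [pi_lt_d2]
  have h0 : 0 ≤ π / r := by positivity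
  have h := one_sub_sq_div_two_le_cos (x := π / r)
  have hcos : 0.898 < cos (π / r) := by nlinarith
  nlinarith

/-- For integers `m ≥ 6` and `r ≥ 7`, the equation `R_{-2,m}(2 cos(π/r), y) = 0`
has a real solution `y > 2`. -/
theorem riley_root_n_neg_two
    (S : ℤ → ℝ → ℝ)
    (hS0 : ∀ z : ℝ, S 0 z = 1)
    (hS1 : ∀ z : ℝ, S 1 z = z)
    (hSrec : ∀ (k : ℤ) (z : ℝ), S k z = z * S (k - 1) z - S (k - 2) z)
    (m : ℤ) (hm : 6 ≤ m) (r : ℕ) (hr : 7 ≤ r) :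
    ∃ y : ℝ, 2 < y ∧ RileyR S (-2) m (2 * Real.cos (π / r)) y = 0 := by
  obtain rfl : S = chebS := by
    funext k z
    exact eq_eval_chebyshev_S hS0 hS1 hSrec k z
  refine exists_RileyR_neg_two_root hm ?_ (lt_sq_two_mul_cos_pi_div hr)
  nlinarith [cos_sq_le_one (π / r)]
end

section
/- Let m and n be nonzero integers and r a positive integer. The equation R_{n,m}(2cos(π/r), y) = 0 has at least one real solution y > 2 in the following cases: (1) r ≥ 3 when n ≥ 3 or n ≤ -4; (2) r ≥ 4 when n = 2 or n = -3; (3) r ≥ 5 when n = 1 and m ∈ {1, 2}, or n = -2 and m = -1; (4) r ≥ 6 when n = 1 and m ≥ 3, or n = -2 and m ≤ -2; (5) r ≥ 7 when n = 1 and m ≤ -4, or n = -2 and m ≥ 6; (6) r ≥ 8 when n = 1 and m ∈ {-2, -3}; (7) r ≥ 9 when n = 1 and m = -1. -/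
open Real

lemma chebS_eq (k : ℤ) (z : ℝ) : chebS k z = z * chebS (k - 1) z - chebS (k - 2) z := by
  simp only [chebS]
  rw [Polynomial.Chebyshev.S_eq]
  simp

@[simp] lemma chebS_zero (z : ℝ) : chebS 0 z = 1 := by simp [chebS]

@[simp] lemma chebS_one (z : ℝ) : chebS 1 z = z := by simp [chebS]

@[simp] lemma chebS_neg_one (z : ℝ) : chebS (-1) z = 0 := by simp [chebS]

lemma chebS_two (z : ℝ) : chebS 2 z = z ^ 2 - 1 := by
  rw [chebS_eq]; norm_num; ring

lemma chebS_three (z : ℝ) : chebS 3 z = z ^ 3 - 2 * z := by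
  rw [chebS_eq]; norm_num [chebS_two]; ring

lemma chebS_four (z : ℝ) : chebS 4 z = z ^ 4 - 3 * z ^ 2 + 1 := by
  rw [chebS_eq]; norm_num [chebS_two, chebS_three]; ring

lemma chebS_five (z : ℝ) : chebS 5 z = z ^ 5 - 4 * z ^ 3 + 3 * z := by
  rw [chebS_eq]; norm_num [chebS_four, chebS_three]; ring

lemma chebS_six (z : ℝ) : chebS 6 z = z ^ 6 - 5 * z ^ 4 + 6 * z ^ 2 - 1 := by
  rw [chebS_eq]; norm_num [chebS_four, chebS_five]; ring

lemma chebS_neg (k : ℤ) (z : ℝ) : chebS (-k) z = -chebS (k - 2) z := by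
  simp [chebS, Polynomial.Chebyshev.S_neg]

lemma chebS_at_two (k : ℤ) : chebS k 2 = k + 1 := by simp [chebS]

lemma chebS_sq_add_sq (k : ℤ) (z : ℝ) :
    chebS k z ^ 2 - z * chebS k z * chebS (k - 1) z + chebS (k - 1) z ^ 2 = 1 := by
  have h := congrArg (Polynomial.eval z) (Polynomial.Chebyshev.S_sq_add_S_sq ℝ (k - 1))
  simp only [sub_add_cancel, Polynomial.eval_sub, Polynomial.eval_add, Polynomial.eval_pow,
    Polynomial.eval_mul, Polynomial.eval_X, Polynomial.eval_one] at h
  simp only [chebS]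
  linarith

lemma continuous_chebS (k : ℤ) : Continuous (chebS k) :=
  (Polynomial.Chebyshev.S ℝ k).continuous

/-- The defining recursion determines `S` on all integer indices. -/
lemma eq_chebS (S : ℤ → ℝ → ℝ) (hS0 : ∀ z : ℝ, S 0 z = 1) (hS1 : ∀ z : ℝ, S 1 z = z)
    (hSrec : ∀ (k : ℤ) (z : ℝ), S k z = z * S (k - 1) z - S (k - 2) z) : S = chebS := by
  have key : ∀ k : ℤ, ∀ z, S k z = chebS k z ∧ S (k + 1) z = chebS (k + 1) z := by
    intro k z
    induction k with
    | zero => simp [hS0, hS1]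
    | succ i ih =>
      refine ⟨ih.2, ?_⟩
      rw [hSrec, chebS_eq]
      ring_nf at ih ⊢
      rw [ih.1, ih.2]
    | pred i ih =>
      have h1 := hSrec (-i + 1) z
      have h2 := chebS_eq (-i + 1) z
      ring_nf at ih h1 h2 ⊢
      exact ⟨by linarith [ih.1, ih.2, congrArg (z * ·) ih.1], ih.1⟩
  funext k z
  exact (key k z).1

lemma chebS_growth {z : ℝ} (hz : 2 ≤ z) (k : ℕ) :
    1 ≤ chebS k z ∧ 1 ≤ chebS k z - chebS (k - 1) z := by
  induction k with
  | zero => simp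
  | succ k ih =>
    have h := chebS_eq (k + 1) z
    rw [add_sub_cancel_right, show (k : ℤ) + 1 - 2 = k - 1 by ring] at h
    push_cast
    rw [add_sub_cancel_right]
    constructor <;> nlinarith [ih.1, ih.2]

lemma chebS_nonneg {z : ℝ} (hz : 2 ≤ z) {k : ℤ} (hk : -1 ≤ k) : 0 ≤ chebS k z := by
  obtain rfl | h : k = -1 ∨ 0 ≤ k := by omega
  · simp
  · lift k to ℕ using h
    linarith [(chebS_growth hz k).1]

lemma one_le_chebS_sub {z : ℝ} (hz : 2 ≤ z) {k : ℤ} (hk : 0 ≤ k) :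
    1 ≤ chebS k z - chebS (k - 1) z := by
  lift k to ℕ using hk
  exact (chebS_growth hz k).2

lemma chebS_neg_arg (z : ℝ) (k : ℕ) :
    chebS k (-z) = (-1) ^ k * chebS k z ∧ chebS (k - 1) (-z) = -(-1) ^ k * chebS (k - 1) z := by
  induction k with
  | zero => simp
  | succ k ih =>
    have h := chebS_eq (k + 1) z
    have h' := chebS_eq (k + 1) (-z)
    rw [add_sub_cancel_right, show (k : ℤ) + 1 - 2 = k - 1 by ring] at h h'
    push_cast
    rw [add_sub_cancel_right, h', ih.1, ih.2, h, pow_succ]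
    constructor <;> ring

lemma chebS_mul_sin (θ : ℝ) (k : ℕ) :
    chebS k (2 * cos θ) * sin θ = sin ((k + 1) * θ) ∧
      chebS (k - 1) (2 * cos θ) * sin θ = sin (k * θ) := by
  induction k with
  | zero => simp
  | succ k ih =>
    have h := chebS_eq (k + 1) (2 * cos θ)
    rw [add_sub_cancel_right, show (k : ℤ) + 1 - 2 = k - 1 by ring] at h
    push_cast
    rw [add_sub_cancel_right]
    refine ⟨?_, ih.1⟩
    have e1 : sin ((k + 1 + 1) * θ) = sin ((k + 1) * θ) * cos θ + cos ((k + 1) * θ) * sin θ := by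
      rw [← sin_add]; ring_nf
    have e2 : sin (k * θ) = sin ((k + 1) * θ) * cos θ - cos ((k + 1) * θ) * sin θ := by
      rw [← sin_sub]; ring_nf
    rw [h, e1]
    linear_combination (2 * cos θ) * ih.1 - ih.2 - e2

/-- At the angles `(2k+1)π/(2N+1)` the consecutive values `S_N` and `S_{N-1}` coincide, with
sign `(-1)^k`. -/
lemma chebS_crossing {N k : ℕ} (hk : k < N) :
    chebS N (2 * cos ((2 * k + 1) * π / (2 * N + 1))) =
        chebS (N - 1) (2 * cos ((2 * k + 1) * π / (2 * N + 1))) ∧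
      0 < (-1) ^ k * chebS N (2 * cos ((2 * k + 1) * π / (2 * N + 1))) := by
  set θ : ℝ := (2 * k + 1) * π / (2 * N + 1) with hθ
  have hkN : (k : ℝ) + 1 ≤ N := by exact_mod_cast hk
  have hk0 : (0 : ℝ) ≤ k := k.cast_nonneg
  have hN : (0 : ℝ) < 2 * N + 1 := by linarith
  have h0 : 0 < θ := by positivity
  have h1 : θ < π := by
    rw [hθ, div_lt_iff₀ hN]
    nlinarith [pi_pos]
  have hs : 0 < sin θ := sin_pos_of_pos_of_lt_pi h0 h1
  have hθN : (2 * N + 1) * θ = (2 * k + 1) * π := by rw [hθ]; field_simp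
  have e1 : sin ((N + 1) * θ) = (-1) ^ k * cos (θ / 2) := by
    rw [show ((N : ℝ) + 1) * θ = (θ / 2 + π / 2) + k * π by linear_combination hθN / 2,
      sin_add_nat_mul_pi, sin_add_pi_div_two]
  have e2 : sin (N * θ) = (-1) ^ k * cos (θ / 2) := by
    rw [show (N : ℝ) * θ = (π / 2 - θ / 2) + k * π by linear_combination hθN / 2,
      sin_add_nat_mul_pi, sin_pi_div_two_sub]
  obtain ⟨f1, f2⟩ := chebS_mul_sin θ N
  refine ⟨mul_right_cancel₀ hs.ne' (by rw [f1, f2, e1, e2]), ?_⟩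
  have hc : 0 < cos (θ / 2) := cos_pos_of_mem_Ioo ⟨by linarith, by linarith⟩
  refine pos_of_mul_pos_left (b := sin θ) ?_ hs.le
  rw [mul_assoc, f1, e1, ← mul_assoc, ← mul_pow]
  simpa using hc

/-- The quantity whose square appears in `chebBeta`. -/
noncomputable def rileyF (m : ℤ) (x y : ℝ) : ℝ :=
  chebS m (chebAlpha x y) + (1 - y) * chebS (m - 1) (chebAlpha x y)

/-- The coefficient of `S_n(β)` in the Riley polynomial. -/
noncomputable def rileyA (m : ℤ) (x y : ℝ) : ℝ :=
  (x ^ 2 - y - 1) * chebS m (chebAlpha x y) - chebS (m - 1) (chebAlpha x y)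

/-- The coefficient of `-S_{n-1}(β)` in the Riley polynomial. -/
noncomputable def rileyB (m : ℤ) (x y : ℝ) : ℝ :=
  (x ^ 2 - y - 1) * chebS (m - 1) (chebAlpha x y) - chebS (m - 2) (chebAlpha x y)

lemma chebBeta_eq (m : ℤ) (x y : ℝ) :
    chebBeta chebS m x y = 2 - (y + 2 - x ^ 2) * rileyF m x y ^ 2 := by
  simp only [chebBeta, rileyF]; ring

lemma RileyR_eq (n m : ℤ) (x y : ℝ) :
    RileyR chebS n m x y = rileyA m x y * chebS n (chebBeta chebS m x y) -
      rileyB m x y * chebS (n - 1) (chebBeta chebS m x y) := rfl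

lemma RileyR_neg_eq (n m : ℤ) (x y : ℝ) :
    RileyR chebS (-1 - n) m x y = rileyB m x y * chebS n (chebBeta chebS m x y) -
      rileyA m x y * chebS (n - 1) (chebBeta chebS m x y) := by
  rw [RileyR_eq, show -1 - n = -(n + 1) by ring, show -(n + 1) - 1 = -(n + 2) by ring,
    chebS_neg, chebS_neg]
  ring_nf

lemma rileyA_eq (m : ℤ) (x y : ℝ) :
    rileyA m x y = rileyB m x y - (y + 2 - x ^ 2) * rileyF m x y := by
  simp only [rileyA, rileyB, rileyF]
  rw [chebS_eq m]
  simp only [chebAlpha]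
  ring

lemma continuous_chebAlpha (x : ℝ) : Continuous (chebAlpha x) := by
  unfold chebAlpha; fun_prop

lemma continuous_rileyF (m : ℤ) (x : ℝ) : Continuous (rileyF m x) := by
  have := continuous_chebAlpha x
  have h (k : ℤ) := (continuous_chebS k).comp this
  simp only [Function.comp_def] at h
  unfold rileyF
  exact (h m).add ((by fun_prop : Continuous fun y : ℝ => 1 - y).mul (h (m - 1)))

lemma continuous_chebBeta (m : ℤ) (x : ℝ) : Continuous (chebBeta chebS m x) := by
  have := continuous_rileyF m x
  simp only [funext (chebBeta_eq m x)]
  fun_prop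

lemma continuous_RileyR (n m : ℤ) (x : ℝ) : Continuous (RileyR chebS n m x) := by
  have ha := continuous_chebAlpha x
  have hb := continuous_chebBeta m x
  have h (k : ℤ) := (continuous_chebS k).comp ha
  have h' (k : ℤ) := (continuous_chebS k).comp hb
  simp only [Function.comp_def] at h h'
  have hy : Continuous fun y : ℝ => x ^ 2 - y - 1 := by fun_prop
  unfold RileyR
  exact (((hy.mul (h m)).sub (h _)).mul (h' n)).sub (((hy.mul (h _)).sub (h _)).mul (h' _))

lemma exists_root_of_mul_neg {n m : ℤ} {x a b : ℝ} (ha : 2 ≤ a) (hb : 2 ≤ b)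
    (h : RileyR chebS n m x a * RileyR chebS n m x b < 0) :
    ∃ y : ℝ, 2 < y ∧ RileyR chebS n m x y = 0 := by
  wlog hab : a ≤ b generalizing a b
  · exact this hb ha (by linarith) (le_of_not_ge hab)
  have hc := (continuous_RileyR n m x).continuousOn (s := Set.Icc a b)
  have hne : RileyR chebS n m x a ≠ 0 := by
    intro h0; simp [h0] at h
  obtain ⟨y, hy, hy0⟩ : ∃ y ∈ Set.Icc a b, RileyR chebS n m x y = 0 := by
    rcases mul_neg_iff.1 h with ⟨h1, h2⟩ | ⟨h1, h2⟩
    · exact intermediate_value_Icc' hab hc ⟨h2.le, h1.le⟩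
    · exact intermediate_value_Icc hab hc ⟨h1.le, h2.le⟩
  refine ⟨y, lt_of_le_of_ne (ha.trans hy.1) ?_, hy0⟩
  rintro rfl
  exact hne (by rw [show a = 2 by linarith [hy.1], hy0])

lemma chebAlpha_eq (x y : ℝ) : chebAlpha x y = 2 + (y - 2) * (y + 2 - x ^ 2) := by
  unfold chebAlpha; ring

lemma two_le_chebAlpha {x y : ℝ} (hx : x ^ 2 < 4) (hy : 2 ≤ y) : 2 ≤ chebAlpha x y := by
  rw [chebAlpha_eq]
  nlinarith

/-- Growth of the Chebyshev values at negative indices. -/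
lemma chebS_of_neg {z : ℝ} (hz : 2 ≤ z) {m : ℤ} (hm : m < 0) :
    chebS (m - 1) z ≤ -1 ∧ chebS m z ≤ 0 ∧ 1 ≤ chebS m z - chebS (m - 1) z := by
  obtain ⟨k, rfl⟩ : ∃ k : ℤ, m = -k := ⟨-m, by ring⟩
  have h1 := one_le_chebS hz (k := k - 1) (by omega)
  have h2 := chebS_nonneg hz (k := k - 2) (by omega)
  have h3 := one_le_chebS_sub hz (k := k - 1) (by omega)
  rw [show -k - 1 = -(k + 1) by ring, chebS_neg, chebS_neg]
  rw [show k - 1 - 1 = k - 2 by ring] at h3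
  rw [show k + 1 - 2 = k - 1 by ring]
  refine ⟨by linarith, by linarith, by linarith⟩

lemma rileyF_pos {m : ℤ} {x y : ℝ} (hm : m ≠ 0) (hx : x ^ 2 < 4) (hy : 2 ≤ y) :
    0 < rileyF m x y := by
  have hα := two_le_chebAlpha hx hy
  rcases lt_or_gt_of_ne hm with h | h
  · obtain ⟨h1, h2, h3⟩ := chebS_of_neg hα h
    unfold rileyF
    nlinarith
  · have h1 := one_le_chebS hα (k := m - 1) (by omega)
    have h2 := one_le_chebS_sub hα (k := m) (by omega)
    have h3 := chebS_sq_add_sq m (chebAlpha x y)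
    by_contra! hF
    unfold rileyF at hF
    set s := chebS m (chebAlpha x y)
    set p := chebS (m - 1) (chebAlpha x y)
    have hα' := chebAlpha_eq x y
    set a := chebAlpha x y
    obtain ⟨v, hv⟩ : ∃ v, v = 4 - x ^ 2 := ⟨_, rfl⟩
    obtain ⟨z, rfl⟩ : ∃ z, y = 2 + z := ⟨y - 2, by ring⟩
    have hz : 0 ≤ z := by linarith
    have hv0 : 0 < v := by linarith
    have ha : a = 2 + z * (z + v) := by rw [hα']; subst hv; ring
    have hs : s ≤ (1 + z) * p := by linarith
    have e : (s - p) * (s - (1 + z) * p) + z * ((1 - (z + v)) * s * p - p ^ 2) = 1 := by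
      linear_combination h3 + s * p * ha
    have t1 : (s - p) * (s - (1 + z) * p) ≤ 0 :=
      mul_nonpos_of_nonneg_of_nonpos (by linarith) (by linarith)
    have t2 : (1 - (z + v)) * s * p - p ^ 2 ≤ 0 := by
      have hs1 : (1 - (z + v)) * s ≤ p := by
        rcases le_total (z + v) 1 with hw | hw
        · have : (1 - (z + v)) * s ≤ (1 - (z + v)) * ((1 + z) * p) :=
            mul_le_mul_of_nonneg_left hs (by linarith)
          have : (1 - (z + v)) * (1 + z) ≤ 1 := by nlinarith [mul_nonneg hz hz, mul_nonneg hz hv0.le]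
          nlinarith
        · nlinarith
      nlinarith
    nlinarith

lemma rileyA_neg_of_pos {m : ℤ} {x : ℝ} (hm : 0 < m) (hx : x ^ 2 < 4) :
    rileyA m x 10 < 0 ∧ rileyB m x 10 < 0 ∧ 1 ≤ rileyF m x 10 := by
  have hα := two_le_chebAlpha hx (by norm_num : (2 : ℝ) ≤ 10)
  have h1 := one_le_chebS hα (k := m - 1) (by omega)
  have h2 := one_le_chebS_sub hα (k := m) (by omega)
  have h3 := one_le_chebS_sub hα (k := m - 1) (by omega)
  have h4 := chebS_nonneg hα (k := m - 2) (by omega)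
  have h5 := chebS_eq m (chebAlpha x 10)
  rw [show m - 1 - 1 = m - 2 by ring] at h3
  have hx0 := sq_nonneg x
  have hα' : 66 ≤ chebAlpha x 10 := by unfold chebAlpha; linarith
  unfold rileyA rileyB rileyF
  refine ⟨by nlinarith, by nlinarith, by nlinarith⟩

lemma rileyA_pos_of_neg {m : ℤ} {x : ℝ} (hm : m < 0) (hx : x ^ 2 < 4) :
    0 < rileyA m x 10 ∧ 0 < rileyB m x 10 ∧ 1 ≤ rileyF m x 10 := by
  have hα := two_le_chebAlpha hx (by norm_num : (2 : ℝ) ≤ 10)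
  obtain ⟨h1, h2, h3⟩ := chebS_of_neg hα hm
  have hx0 := sq_nonneg x
  have hF : 1 ≤ rileyF m x 10 := by unfold rileyF; linarith
  have hA : 0 < rileyA m x 10 := by unfold rileyA; nlinarith
  have := rileyA_eq m x 10
  exact ⟨hA, by nlinarith, hF⟩

lemma chebBeta_ten_le {m : ℤ} {x : ℝ} (hm : m ≠ 0) (hx : x ^ 2 < 4) :
    chebBeta chebS m x 10 ≤ -2 := by
  have hF : 1 ≤ rileyF m x 10 := by
    rcases lt_or_gt_of_ne hm with h | h
    · exact (rileyA_pos_of_neg h hx).2.2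
    · exact (rileyA_neg_of_pos h hx).2.2
  rw [chebBeta_eq]
  nlinarith

lemma chebS_sign {b : ℝ} (hb : b ≤ -2) (N : ℕ) :
    0 < (-1) ^ N * chebS N b ∧ (-1) ^ N * chebS (N - 1) b ≤ 0 := by
  have h := chebS_neg_arg (-b) N
  rw [neg_neg] at h
  have hb' : 2 ≤ -b := by linarith
  have hsq : ((-1 : ℝ) ^ N) * (-1) ^ N = 1 := by rw [← mul_pow]; simp
  have h1 := one_le_chebS hb' (k := N) (by omega)
  have h2 := chebS_nonneg hb' (k := N - 1) (by omega)
  rw [h.1, h.2]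
  constructor
  · rw [← mul_assoc, hsq]; linarith
  · rw [neg_mul, mul_neg, ← mul_assoc, hsq]; linarith

/-- Sign of the Riley polynomials at `y = 10`. -/
lemma RileyR_ten_of_pos {m : ℤ} {x : ℝ} (hm : 0 < m) (hx : x ^ 2 < 4) (N : ℕ) :
    (-1) ^ N * RileyR chebS N m x 10 < 0 ∧ (-1) ^ N * RileyR chebS (-1 - N) m x 10 < 0 := by
  obtain ⟨hA, hB, -⟩ := rileyA_neg_of_pos hm hx
  obtain ⟨h1, h2⟩ := chebS_sign (chebBeta_ten_le hm.ne' hx) N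
  rw [RileyR_eq, RileyR_neg_eq]
  constructor <;> nlinarith [mul_neg_of_neg_of_pos hA h1, mul_neg_of_neg_of_pos hB h1,
    mul_nonneg_of_nonpos_of_nonpos hA.le h2, mul_nonneg_of_nonpos_of_nonpos hB.le h2]

lemma RileyR_ten_of_neg {m : ℤ} {x : ℝ} (hm : m < 0) (hx : x ^ 2 < 4) (N : ℕ) :
    0 < (-1) ^ N * RileyR chebS N m x 10 ∧ 0 < (-1) ^ N * RileyR chebS (-1 - N) m x 10 := by
  obtain ⟨hA, hB, -⟩ := rileyA_pos_of_neg hm hx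
  obtain ⟨h1, h2⟩ := chebS_sign (chebBeta_ten_le hm.ne hx) N
  rw [RileyR_eq, RileyR_neg_eq]
  constructor <;> nlinarith [mul_pos hA h1, mul_pos hB h1,
    mul_nonpos_of_nonneg_of_nonpos hA.le h2, mul_nonpos_of_nonneg_of_nonpos hB.le h2]

lemma exists_root_of_sign {n m : ℤ} {x y e : ℝ} (hy : 2 ≤ y)
    (h : (e * RileyR chebS n m x y) * (e * RileyR chebS n m x 10) < 0) :
    ∃ y : ℝ, 2 < y ∧ RileyR chebS n m x y = 0 := by
  refine exists_root_of_mul_neg hy (by norm_num : (2 : ℝ) ≤ 10) ?_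
  by_contra! hcon
  nlinarith [mul_nonneg (sq_nonneg e) hcon]

/-- For `m > 0` a point with the opposite sign to that at `y = 10` gives a root. -/
lemma exists_root_of_pos {m : ℤ} {x : ℝ} (hm : 0 < m) (hx : x ^ 2 < 4) (N : ℕ) {y : ℝ}
    (hy : 2 ≤ y) :
    (0 < (-1) ^ N * RileyR chebS N m x y → ∃ y : ℝ, 2 < y ∧ RileyR chebS N m x y = 0) ∧
    (0 < (-1) ^ N * RileyR chebS (-1 - N) m x y →
      ∃ y : ℝ, 2 < y ∧ RileyR chebS (-1 - N) m x y = 0) :=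
  ⟨fun h => exists_root_of_sign hy (mul_neg_of_pos_of_neg h (RileyR_ten_of_pos hm hx N).1),
    fun h => exists_root_of_sign hy (mul_neg_of_pos_of_neg h (RileyR_ten_of_pos hm hx N).2)⟩

lemma exists_root_of_neg {m : ℤ} {x : ℝ} (hm : m < 0) (hx : x ^ 2 < 4) (N : ℕ) {y : ℝ}
    (hy : 2 ≤ y) :
    ((-1) ^ N * RileyR chebS N m x y < 0 → ∃ y : ℝ, 2 < y ∧ RileyR chebS N m x y = 0) ∧
    ((-1) ^ N * RileyR chebS (-1 - N) m x y < 0 →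
      ∃ y : ℝ, 2 < y ∧ RileyR chebS (-1 - N) m x y = 0) :=
  ⟨fun h => exists_root_of_sign hy (mul_neg_of_neg_of_pos h (RileyR_ten_of_neg hm hx N).1),
    fun h => exists_root_of_sign hy (mul_neg_of_neg_of_pos h (RileyR_ten_of_neg hm hx N).2)⟩

lemma chebAlpha_two (x : ℝ) : chebAlpha x 2 = 2 := by unfold chebAlpha; ring

lemma chebBeta_two (m : ℤ) (x : ℝ) : chebBeta chebS m x 2 = x ^ 2 - 2 := by
  simp only [chebBeta, chebAlpha_two, chebS_at_two]
  push_cast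
  ring

/-- Values of the Riley polynomials at `y = 2`. -/
lemma RileyR_two (n m : ℤ) (x : ℝ) :
    RileyR chebS n m x 2 = (1 + (m + 1) * (x ^ 2 - 4)) * chebS n (x ^ 2 - 2) -
        (1 + m * (x ^ 2 - 4)) * chebS (n - 1) (x ^ 2 - 2) ∧
      RileyR chebS (-1 - n) m x 2 = (1 + m * (x ^ 2 - 4)) * chebS n (x ^ 2 - 2) -
        (1 + (m + 1) * (x ^ 2 - 4)) * chebS (n - 1) (x ^ 2 - 2) := by
  have hA : rileyA m x 2 = 1 + (m + 1) * (x ^ 2 - 4) := by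
    simp only [rileyA, chebAlpha_two, chebS_at_two]; push_cast; ring
  have hB : rileyB m x 2 = 1 + m * (x ^ 2 - 4) := by
    simp only [rileyB, chebAlpha_two, chebS_at_two]; push_cast; ring
  rw [RileyR_eq, RileyR_neg_eq, chebBeta_two, hA, hB]
  exact ⟨rfl, rfl⟩

lemma exists_chebBeta_eq {m : ℤ} {x b : ℝ} (hm : m ≠ 0) (hx : x ^ 2 < 4) (hb : -2 ≤ b)
    (hb' : b ≤ x ^ 2 - 2) : ∃ y : ℝ, 2 ≤ y ∧ chebBeta chebS m x y = b := by
  obtain ⟨y, hy, h⟩ := intermediate_value_Icc' (by norm_num : (2 : ℝ) ≤ 10)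
    (continuous_chebBeta m x).continuousOn
    ⟨(chebBeta_ten_le hm hx).trans hb, by rwa [chebBeta_two]⟩
  exact ⟨y, hy.1, h⟩

/-- At the angles `(2k+1)π/(2N+1)` the sign of the Riley polynomials is determined by `k`. -/
lemma exists_sign_at_crossing {m : ℤ} {x : ℝ} (hm : m ≠ 0) (hx : x ^ 2 < 4) {N k : ℕ}
    (hk : k < N) (h : 2 * cos ((2 * k + 1) * π / (2 * N + 1)) ≤ x ^ 2 - 2) :
    ∃ y : ℝ, 2 ≤ y ∧ (-1) ^ k * RileyR chebS N m x y < 0 ∧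
      0 < (-1) ^ k * RileyR chebS (-1 - N) m x y := by
  obtain ⟨y, hy, hb⟩ := exists_chebBeta_eq hm hx
    (by linarith [neg_one_le_cos ((2 * k + 1) * π / (2 * N + 1))]) h
  obtain ⟨h1, h2⟩ := chebS_crossing hk
  refine ⟨y, hy, ?_⟩
  have hw : 0 < (y + 2 - x ^ 2) * rileyF m x y :=
    mul_pos (by linarith) (rileyF_pos hm hx hy)
  rw [RileyR_eq, RileyR_neg_eq, hb, ← h1, rileyA_eq]
  constructor <;> nlinarith [mul_pos hw h2]

lemma exists_root_of_pos_of_le {m : ℤ} {x : ℝ} (hm : 0 < m) (hx : x ^ 2 < 4) (N : ℕ)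
    (h : 2 * cos ((2 * N + 1) * π / (2 * N + 3)) ≤ x ^ 2 - 2) :
    ∃ y : ℝ, 2 < y ∧ RileyR chebS (N + 1) m x y = 0 := by
  obtain ⟨y, hy, h1, -⟩ := exists_sign_at_crossing hm.ne' hx (Nat.lt_succ_self N)
    (by push_cast; rwa [show 2 * ((N : ℝ) + 1) + 1 = 2 * N + 3 by ring])
  have := (exists_root_of_pos hm hx (N + 1) hy).1
  push_cast at this h1
  exact this (by rw [pow_succ]; linarith)

lemma exists_root_of_neg_of_le {m : ℤ} {x : ℝ} (hm : m < 0) (hx : x ^ 2 < 4) (N : ℕ)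
    (h : 2 * cos ((2 * N + 1) * π / (2 * N + 3)) ≤ x ^ 2 - 2) :
    ∃ y : ℝ, 2 < y ∧ RileyR chebS (-1 - (N + 1)) m x y = 0 := by
  obtain ⟨y, hy, -, h1⟩ := exists_sign_at_crossing hm.ne hx (Nat.lt_succ_self N)
    (by push_cast; rwa [show 2 * ((N : ℝ) + 1) + 1 = 2 * N + 3 by ring])
  have := (exists_root_of_neg hm hx (N + 1) hy).2
  push_cast at this h1
  exact this (by rw [pow_succ]; linarith)

lemma exists_root_of_crossing {m : ℤ} {x : ℝ} (hm : m ≠ 0) (hx : x ^ 2 < 4) (N : ℕ)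
    (h : 2 * cos ((2 * N + 1) * π / (2 * N + 5)) ≤ x ^ 2 - 2) :
    (m < 0 → ∃ y : ℝ, 2 < y ∧ RileyR chebS (N + 2) m x y = 0) ∧
      (0 < m → ∃ y : ℝ, 2 < y ∧ RileyR chebS (-1 - (N + 2)) m x y = 0) := by
  obtain ⟨y, hy, h1, h2⟩ := exists_sign_at_crossing hm hx (show N < N + 2 by omega)
    (by push_cast; rwa [show 2 * ((N : ℝ) + 2) + 1 = 2 * N + 5 by ring])
  push_cast at h1 h2
  constructor
  · intro hm
    have := (exists_root_of_neg hm hx (N + 2) hy).1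
    push_cast at this
    exact this (by rw [pow_add]; linarith)
  · intro hm
    have := (exists_root_of_pos hm hx (N + 2) hy).2
    push_cast at this
    exact this (by rw [pow_add]; linarith)

lemma four_sub_sq_two_mul_cos (a : ℝ) : 4 - (2 * cos a) ^ 2 = 4 * sin a ^ 2 := by
  linarith [sin_sq_add_cos_sq a]

lemma two_mul_cos_sq_lt {r : ℕ} (hr : 2 ≤ r) : (2 * cos (π / r)) ^ 2 < 4 := by
  have hr' : (2 : ℝ) ≤ r := by exact_mod_cast hr
  have hs : 0 < sin (π / r) := sin_pos_of_pos_of_lt_pi (by positivity)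
    (div_lt_self pi_pos (by linarith))
  nlinarith [four_sub_sq_two_mul_cos (π / r)]

lemma two_mul_cos_le {r : ℕ} (hr : 2 ≤ r) {p q : ℝ} (hq : 0 < q) (hpq : p ≤ q)
    (h : 2 * q ≤ p * r) : 2 * cos (p * π / q) ≤ (2 * cos (π / r)) ^ 2 - 2 := by
  have hr' : (2 : ℝ) ≤ r := by exact_mod_cast hr
  have e : (2 * cos (π / r)) ^ 2 - 2 = 2 * cos (2 * π / r) := by
    rw [mul_div_assoc, cos_two_mul]; ring
  rw [e]
  have : cos (p * π / q) ≤ cos (2 * π / r) := by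
    apply cos_le_cos_of_nonneg_of_le_pi (by positivity)
    · rw [div_le_iff₀ hq]; nlinarith [pi_pos]
    · rw [div_le_div_iff₀ (by linarith) hq]; nlinarith [pi_pos]
  linarith

/-- The parameter `4 - x²` is antitone in the order `r`. -/
lemma four_sub_sq_le {k r : ℕ} (hk : 2 ≤ k) (h : k ≤ r) :
    4 - (2 * cos (π / r)) ^ 2 ≤ 4 * sin (π / k) ^ 2 := by
  rw [four_sub_sq_two_mul_cos]
  have hk' : (2 : ℝ) ≤ k := by exact_mod_cast hk
  have hr' : (k : ℝ) ≤ r := by exact_mod_cast h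
  have h1 : π / r ≤ π / k := by gcongr
  have h2 : π / k ≤ π / 2 := by gcongr
  have h3 : 0 < π / r := div_pos pi_pos (by linarith)
  have h4 : sin (π / r) ≤ sin (π / k) := sin_le_sin_of_le_of_le_pi_div_two (by linarith) h2 h1
  have h5 : 0 ≤ sin (π / r) := sin_nonneg_of_nonneg_of_le_pi h3.le (by linarith)
  gcongr

lemma four_sub_sq_lt_of_seven_le {r : ℕ} (hr : 7 ≤ r) :
    4 - (2 * cos (π / r)) ^ 2 < 191 / 250 := by
  have h := four_sub_sq_le (by norm_num) hr
  have h0 : 0 < π / 7 := by positivity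
  have h1 : π / 7 < 449 / 1000 := by linarith [pi_lt_d4]
  have h1' : 448 / 1000 < π / 7 := by linarith [pi_gt_d4]
  have h2 := abs_le.1 (sin_bound (x := π / 7) (by rw [abs_of_pos h0]; linarith))
  rw [abs_of_pos h0] at h2
  have h3 : (π / 7) ^ 5 ≤ (449 / 1000) ^ 5 := by gcongr
  have h4 : (448 / 1000) ^ 3 ≤ (π / 7) ^ 3 := by gcongr
  have h5 : sin (π / 7) ≤ 437 / 1000 := by norm_num at h3 h4; linarith [h2.2]
  have h6 : 0 ≤ sin (π / 7) := sin_nonneg_of_nonneg_of_le_pi h0.le (by linarith [pi_pos])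
  push_cast at h
  nlinarith

lemma four_sub_sq_lt_of_eight_le {r : ℕ} (hr : 8 ≤ r) :
    4 - (2 * cos (π / r)) ^ 2 < 617 / 1000 := by
  have h := four_sub_sq_le (by norm_num) hr
  have h5 := sin_lt (show 0 < π / 8 by positivity)
  have h6 : 0 ≤ sin (π / 8) := sin_nonneg_of_nonneg_of_le_pi (by positivity) (by linarith [pi_pos])
  push_cast at h
  nlinarith [pi_lt_d4]

lemma four_sub_sq_lt_of_nine_le {r : ℕ} (hr : 9 ≤ r) : 4 - (2 * cos (π / r)) ^ 2 < 1 / 2 := by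
  have h := four_sub_sq_le (by norm_num) hr
  have h5 := sin_lt (show 0 < π / 9 by positivity)
  have h6 : 0 ≤ sin (π / 9) := sin_nonneg_of_nonneg_of_le_pi (by positivity) (by linarith [pi_pos])
  push_cast at h
  nlinarith [pi_lt_d4]

/-- For `m ≥ 6` the factor `rileyF` has returned above `1` when `y + 2 - x² = 19/50`. -/
lemma one_le_rileyF {m : ℤ} {x : ℝ} (hm : 6 ≤ m) (hx : x ^ 2 < 4) (hx' : 181 / 50 ≤ x ^ 2) :
    1 ≤ rileyF m x (x ^ 2 - 81 / 50) := by
  obtain ⟨z, hz⟩ : ∃ z, z = x ^ 2 - 181 / 50 := ⟨_, rfl⟩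
  have hz0 : 0 ≤ z := by linarith
  obtain ⟨t, ht⟩ : ∃ t, t = 19 / 50 * z := ⟨_, rfl⟩
  have ht0 : 0 ≤ t := by linarith
  have ht1 : t ≤ 1444 / 10000 := by linarith
  have hα : chebAlpha x (x ^ 2 - 81 / 50) = 2 + t := by rw [chebAlpha_eq, ht, hz]; ring
  have hF (k : ℤ) : rileyF k x (x ^ 2 - 81 / 50) =
      chebS k (2 + t) - (1 + z) * chebS (k - 1) (2 + t) := by
    unfold rileyF; rw [hα, hz]; ring
  have p2 : t ^ 2 ≤ (1444 / 10000) ^ 2 := by gcongr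
  have p3 : t ^ 3 ≤ (1444 / 10000) ^ 3 := by gcongr
  have p4 : t ^ 4 ≤ (1444 / 10000) ^ 4 := by gcongr
  have p5 : t ^ 5 ≤ (1444 / 10000) ^ 5 := by gcongr
  norm_num at p2 p3 p4 p5
  have key : ∀ k : ℕ, 1 ≤ rileyF (6 + k) x (x ^ 2 - 81 / 50) ∧
      rileyF (6 + k - 1) x (x ^ 2 - 81 / 50) ≤ rileyF (6 + k) x (x ^ 2 - 81 / 50) := by
    intro k
    induction k with
    | zero =>
      simp only [hF, Nat.cast_zero, add_zero]
      norm_num only [chebS_four, chebS_five, chebS_six]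
      constructor
      · have : 0 ≤ z * (1.98 - 8.4 * t - 24.08 * t ^ 2 - 18.9 * t ^ 3 - 5.82 * t ^ 4
            - 0.62 * t ^ 5) := mul_nonneg hz0 (by norm_num; linarith)
        rw [ht] at this ⊢
        norm_num at this
        linarith
      · have : 0 ≤ z * (1.28 - 1.7 * t - 13.72 * t ^ 2 - 14.32 * t ^ 3 - 5.2 * t ^ 4
            - 0.62 * t ^ 5) := mul_nonneg hz0 (by norm_num; linarith)
        rw [ht] at this ⊢
        norm_num at this
        linarith
    | succ k ih =>
      simp only [hF] at ih ⊢
      have h1 := chebS_eq (6 + (k + 1)) (2 + t)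
      have h2 := chebS_eq (6 + k) (2 + t)
      push_cast
      ring_nf at ih h1 h2 ⊢
      constructor <;> nlinarith
  obtain ⟨k, rfl⟩ : ∃ k : ℕ, m = 6 + k := ⟨(m - 6).toNat, by omega⟩
  exact (key k).1

lemma exists_root_neg_two_of_six_le {m : ℤ} {x : ℝ} (hm : 6 ≤ m) (hx : x ^ 2 < 4)
    (hx' : 4 - x ^ 2 < 191 / 250) : ∃ y : ℝ, 2 < y ∧ RileyR chebS (-2) m x y = 0 := by
  have hm' : (6 : ℝ) ≤ m := by exact_mod_cast hm
  suffices h : ∃ y, 2 ≤ y ∧ RileyR chebS (-1 - 1) m x y < 0 by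
    obtain ⟨y, hy, h⟩ := h
    have := (exists_root_of_pos (m := m) (by omega) hx 1 hy).2
    norm_num at this h
    exact this h
  rcases le_or_gt (x ^ 2) (181 / 50) with h | h
  · refine ⟨2, le_rfl, ?_⟩
    rw [(RileyR_two 1 m x).2]
    norm_num
    obtain ⟨v, hv⟩ : ∃ v, v = 4 - x ^ 2 := ⟨_, rfl⟩
    have : 1 < 6 * (v * (1 - v)) := by nlinarith
    rw [show x ^ 2 = 4 - v by linarith]
    nlinarith
  · have hF := one_le_rileyF hm hx h.le
    obtain ⟨y, hy, hb⟩ := intermediate_value_Icc' (by linarith : 2 ≤ x ^ 2 - 81 / 50)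
      (continuous_chebBeta m x).continuousOn (show (81 / 50 : ℝ) ∈ _ from
        ⟨by rw [chebBeta_eq]; nlinarith, by rw [chebBeta_two]; linarith⟩)
    refine ⟨y, hy.1, ?_⟩
    have hy2 : 2 < y := by
      refine lt_of_le_of_ne hy.1 ?_
      rintro rfl
      rw [chebBeta_two] at hb
      linarith
    rw [RileyR_neg_eq, hb, rileyA_eq]
    norm_num
    rw [chebBeta_eq] at hb
    have hFp := rileyF_pos (by omega : m ≠ 0) hx hy.1
    have hα := two_le_chebAlpha hx hy.1
    have h1 := one_le_chebS hα (k := m - 1) (by omega)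
    have h2 := chebS_eq m (chebAlpha x y)
    have h3 := chebS_sq_add_sq m (chebAlpha x y)
    have hB : rileyB m x y = (x ^ 2 - y - 1) * chebS (m - 1) (chebAlpha x y) -
      chebS (m - 2) (chebAlpha x y) := rfl
    have hFe : rileyF m x y = chebS m (chebAlpha x y) +
      (1 - y) * chebS (m - 1) (chebAlpha x y) := rfl
    have hα' := chebAlpha_eq x y
    set f := rileyF m x y
    set p := chebS (m - 1) (chebAlpha x y)
    set s := chebS m (chebAlpha x y)
    set a := chebAlpha x y
    obtain ⟨w, hw⟩ : ∃ w, w = y + 2 - x ^ 2 := ⟨_, rfl⟩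
    rw [← hw] at hb hα' ⊢
    have hw1 : w ≤ 19 / 50 := by linarith [hy.2]
    have hw0 : 0 < w := by linarith
    have hf1 : 1 ≤ f := by
      by_contra! hf
      nlinarith
    have hs : s = f + (y - 1) * p := by linarith
    have hBe : rileyB m x y = f - (w * (y - 1) - (y - 2)) * p := by
      rw [hB, show chebS (m - 2) a = a * p - s by linarith, hs, hα',
          show x ^ 2 = y + 2 - w by linarith]
      ring
    have e : (y - 2) * p * ((w * (y - 1) - (y - 2)) * p - (2 - w) * f) = f ^ 2 - 1 := by
      rw [hs, hα'] at h3
      linear_combination -h3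
    have hq : (2 - w) * f ≤ (w * (y - 1) - (y - 2)) * p := by
      have h0 : 0 < (y - 2) * p := mul_pos (by linarith) (by linarith)
      have : 0 ≤ (y - 2) * p * ((w * (y - 1) - (y - 2)) * p - (2 - w) * f) := by
        rw [e]; nlinarith
      linarith [nonneg_of_mul_nonneg_right this h0]
    rw [hBe]
    nlinarith

lemma exists_root_of_three_le {m : ℤ} (hm : m ≠ 0) {N r : ℕ} (hN : 3 ≤ N) (hr : 3 ≤ r) :
    (∃ y : ℝ, 2 < y ∧ RileyR chebS N m (2 * cos (π / r)) y = 0) ∧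
      ∃ y : ℝ, 2 < y ∧ RileyR chebS (-1 - N) m (2 * cos (π / r)) y = 0 := by
  have hx : (2 * cos (π / r)) ^ 2 < 4 := two_mul_cos_sq_lt (by omega)
  -- the two sign patterns for which a single crossing suffices
  have easy : (0 < m → ∃ y : ℝ, 2 < y ∧ RileyR chebS N m (2 * cos (π / r)) y = 0) ∧
      (m < 0 → ∃ y : ℝ, 2 < y ∧ RileyR chebS (-1 - N) m (2 * cos (π / r)) y = 0) := by
    obtain ⟨j, rfl⟩ : ∃ j, N = j + 1 := ⟨N - 1, by omega⟩
    have hc : 2 * cos ((2 * j + 1) * π / (2 * j + 3)) ≤ (2 * cos (π / r)) ^ 2 - 2 := by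
      refine two_mul_cos_le (by omega) (by positivity) (by linarith) ?_
      norm_cast
      nlinarith
    push_cast
    exact ⟨fun h => exists_root_of_pos_of_le h hx j hc, fun h => exists_root_of_neg_of_le h hx j hc⟩
  suffices hard : (m < 0 → ∃ y : ℝ, 2 < y ∧ RileyR chebS N m (2 * cos (π / r)) y = 0) ∧
      (0 < m → ∃ y : ℝ, 2 < y ∧ RileyR chebS (-1 - N) m (2 * cos (π / r)) y = 0) by
    rcases lt_or_gt_of_ne hm with h | h
    · exact ⟨hard.1 h, easy.2 h⟩
    · exact ⟨easy.1 h, hard.2 h⟩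
  by_cases hsmall : (r = 3 ∧ N ≤ 5) ∨ (r = 4 ∧ N = 3)
  · have hx3 : (2 * cos (π / (3 : ℕ))) ^ 2 = 1 := by
      push_cast; rw [cos_pi_div_three]; norm_num
    have hx4 : (2 * cos (π / (4 : ℕ))) ^ 2 = 2 := by
      push_cast; rw [cos_pi_div_four, mul_div_cancel₀ _ two_ne_zero]; norm_num
    have hneg (h : m < 0) : (m : ℝ) ≤ -1 := by exact_mod_cast Int.le_sub_one_of_lt h
    have hpos (h : 0 < m) : (1 : ℝ) ≤ m := by exact_mod_cast h
    constructor <;> intro h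
    · refine (exists_root_of_neg h hx N le_rfl).1 ?_
      rw [(RileyR_two N m _).1]
      have hm' := hneg h
      obtain ⟨rfl, hN'⟩ | ⟨rfl, rfl⟩ := hsmall
      · rw [hx3]
        interval_cases N <;>
          norm_num [chebS_two, chebS_three, chebS_four, chebS_five] <;> linarith
      · rw [hx4]
        norm_num [chebS_two, chebS_three, chebS_four, chebS_five]
        linarith
    · refine (exists_root_of_pos h hx N le_rfl).2 ?_
      rw [(RileyR_two N m _).2]
      have hm' := hpos h
      obtain ⟨rfl, hN'⟩ | ⟨rfl, rfl⟩ := hsmall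
      · rw [hx3]
        interval_cases N <;>
          norm_num [chebS_two, chebS_three, chebS_four, chebS_five] <;> linarith
      · rw [hx4]
        norm_num [chebS_two, chebS_three, chebS_four, chebS_five]
        linarith
  · obtain ⟨j, rfl⟩ : ∃ j, N = j + 2 := ⟨N - 2, by omega⟩
    have := exists_root_of_crossing hm hx j ?_
    · exact_mod_cast this
    refine two_mul_cos_le (by omega) (by positivity) (by linarith) ?_
    norm_cast
    obtain h | h | h : (r = 3 ∧ 4 ≤ j) ∨ (r = 4 ∧ 2 ≤ j) ∨ (5 ≤ r ∧ 1 ≤ j) := by omega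
    · obtain ⟨rfl, h⟩ := h; omega
    · obtain ⟨rfl, h⟩ := h; omega
    · nlinarith [h.1, h.2]

lemma exists_root_of_eq_two {m : ℤ} (hm : m ≠ 0) {r : ℕ} (hr : 4 ≤ r) :
    (∃ y : ℝ, 2 < y ∧ RileyR chebS 2 m (2 * cos (π / r)) y = 0) ∧
      ∃ y : ℝ, 2 < y ∧ RileyR chebS (-3) m (2 * cos (π / r)) y = 0 := by
  have hx : (2 * cos (π / r)) ^ 2 < 4 := two_mul_cos_sq_lt (by omega)
  have hr' : (4 : ℝ) ≤ r := by exact_mod_cast hr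
  have easy : (0 < m → ∃ y : ℝ, 2 < y ∧ RileyR chebS 2 m (2 * cos (π / r)) y = 0) ∧
      (m < 0 → ∃ y : ℝ, 2 < y ∧ RileyR chebS (-3) m (2 * cos (π / r)) y = 0) := by
    have hc : 2 * cos ((2 * (1 : ℕ) + 1) * π / (2 * (1 : ℕ) + 3)) ≤ (2 * cos (π / r)) ^ 2 - 2 :=
      two_mul_cos_le (by omega) (by positivity) (by norm_num) (by push_cast; linarith)
    have h1 := fun h => exists_root_of_pos_of_le (m := m) h hx 1 hc
    have h2 := fun h => exists_root_of_neg_of_le (m := m) h hx 1 hc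
    norm_num at h1 h2
    exact ⟨h1, h2⟩
  suffices hard : (m < 0 → ∃ y : ℝ, 2 < y ∧ RileyR chebS 2 m (2 * cos (π / r)) y = 0) ∧
      (0 < m → ∃ y : ℝ, 2 < y ∧ RileyR chebS (-3) m (2 * cos (π / r)) y = 0) by
    rcases lt_or_gt_of_ne hm with h | h
    · exact ⟨hard.1 h, easy.2 h⟩
    · exact ⟨easy.1 h, hard.2 h⟩
  rcases le_or_gt (2 * cos (π / 5)) ((2 * cos (π / r)) ^ 2 - 2) with hg | hg
  · have h := exists_root_of_crossing hm hx 0 (by simpa using hg)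
    norm_num at h
    exact h
  obtain ⟨b, hb⟩ : ∃ b, b = (2 * cos (π / r)) ^ 2 - 2 := ⟨_, rfl⟩
  have hb2 : b < 2 := by linarith
  have hbb : 0 ≤ b ∧ b ^ 2 - b - 1 ≤ 0 ∧ (b = 0 ∨ 0 < b) := by
    obtain rfl | h5 : r = 4 ∨ 5 ≤ r := by omega
    · have : b = 0 := by
        rw [hb]; push_cast; rw [cos_pi_div_four, mul_div_cancel₀ _ two_ne_zero]; norm_num
      simp [this]
    · have h5' : (5 : ℝ) ≤ r := by exact_mod_cast h5
      have hc := two_mul_cos_le (r := r) (p := 2) (q := 5) (by omega) (by norm_num) (by norm_num)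
        (by linarith)
      have hq := quadratic_root_cos_pi_div_five
      rw [mul_div_assoc, cos_two_mul, ← hb] at hc
      rw [← hb] at hg
      have hc1 : 1 / 2 < cos (π / 5) := by
        rw [← cos_pi_div_three]
        exact cos_lt_cos_of_nonneg_of_le_pi (by positivity) (by linarith [pi_pos])
          (by linarith [pi_pos])
      have hb0 : 0 < b := by nlinarith
      exact ⟨hb0.le, by nlinarith, Or.inr hb0⟩
  obtain ⟨hb0, hb1, hb3⟩ := hbb
  constructor <;> intro h
  · have hm' : (m : ℝ) ≤ -1 := by exact_mod_cast Int.le_sub_one_of_lt h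
    have := (exists_root_of_neg h hx 2 le_rfl).1
    norm_num at this
    refine this ?_
    rw [(RileyR_two 2 m _).1, show (2 * cos (π / r)) ^ 2 = b + 2 by linarith]
    norm_num [chebS_two]
    have k1 : (1 + m * (b - 2)) * (b ^ 2 - b - 1) ≤ (3 - b) * (b ^ 2 - b - 1) :=
      mul_le_mul_of_nonpos_right (by nlinarith) hb1
    obtain rfl | hb3 := hb3
    · norm_num at k1 ⊢; linarith
    · nlinarith [mul_pos hb3 (show 0 < 2 - b by linarith)]
  · have hm' : (1 : ℝ) ≤ m := by exact_mod_cast h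
    have := (exists_root_of_pos h hx 2 le_rfl).2
    norm_num at this
    refine this ?_
    have hR := (RileyR_two 2 m (2 * cos (π / r))).2
    norm_num at hR
    rw [hR, show (2 * cos (π / r)) ^ 2 = b + 2 by linarith]
    norm_num [chebS_two]
    have k1 : (b - 1) * (b ^ 2 - b - 1) ≤ (1 + m * (b - 2)) * (b ^ 2 - b - 1) :=
      mul_le_mul_of_nonpos_right (by nlinarith) hb1
    have k2 : 0 < b * (b - 1) * (b - 2) + 1 := by
      rcases le_total b 1 with h1 | h1
      · nlinarith [mul_nonneg (mul_nonneg hb0 (sub_nonneg.2 h1)) (show 0 ≤ 2 - b by linarith)]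
      · nlinarith [sq_nonneg (b - 1), mul_nonneg (sub_nonneg.2 h1) (sq_nonneg (b - 1))]
    nlinarith

lemma exists_root_of_six_le {m : ℤ} {r : ℕ} (hr : 6 ≤ r) :
    (0 < m → ∃ y : ℝ, 2 < y ∧ RileyR chebS 1 m (2 * cos (π / r)) y = 0) ∧
      (m < 0 → ∃ y : ℝ, 2 < y ∧ RileyR chebS (-2) m (2 * cos (π / r)) y = 0) := by
  have hx : (2 * cos (π / r)) ^ 2 < 4 := two_mul_cos_sq_lt (by omega)
  have hr' : (6 : ℝ) ≤ r := by exact_mod_cast hr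
  have hc : 2 * cos ((2 * (0 : ℕ) + 1) * π / (2 * (0 : ℕ) + 3)) ≤ (2 * cos (π / r)) ^ 2 - 2 :=
    two_mul_cos_le (by omega) (by positivity) (by norm_num) (by push_cast; linarith)
  have h1 := fun h => exists_root_of_pos_of_le (m := m) h hx 0 hc
  have h2 := fun h => exists_root_of_neg_of_le (m := m) h hx 0 hc
  norm_num at h1 h2
  exact ⟨h1, h2⟩

/-- The case `r = 5`, where the value at `y = 2` is used instead of a crossing. -/
lemma exists_root_of_eq_five :
    (∃ y : ℝ, 2 < y ∧ RileyR chebS 1 1 (2 * cos (π / (5 : ℕ))) y = 0) ∧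
      (∃ y : ℝ, 2 < y ∧ RileyR chebS 1 2 (2 * cos (π / (5 : ℕ))) y = 0) ∧
      ∃ y : ℝ, 2 < y ∧ RileyR chebS (-2) (-1) (2 * cos (π / (5 : ℕ))) y = 0 := by
  have hx : (2 * cos (π / (5 : ℕ))) ^ 2 < 4 := two_mul_cos_sq_lt (by norm_num)
  have hx2 : (2 * cos (π / (5 : ℕ))) ^ 2 = (3 + √5) / 2 := by
    push_cast
    rw [cos_pi_div_five]
    linear_combination (1 / 4) * sq_sqrt (show (0 : ℝ) ≤ 5 by norm_num)
  generalize 2 * cos (π / (5 : ℕ)) = x at hx hx2 ⊢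
  have hs := sq_sqrt (show (0 : ℝ) ≤ 5 by norm_num)
  have hs0 : 2.2 < √5 := by rw [lt_sqrt] <;> norm_num
  have h1 := (exists_root_of_pos (m := 1) (by norm_num) hx 1 le_rfl).1
  have h2 := (exists_root_of_pos (m := 2) (by norm_num) hx 1 le_rfl).1
  have h3 := (exists_root_of_neg (m := -1) (by norm_num) hx 1 le_rfl).2
  have e3 := (RileyR_two 1 (-1) x).2
  rw [Nat.cast_one, (RileyR_two 1 _ _).1, hx2] at h1 h2
  rw [Nat.cast_one, e3, hx2] at h3
  norm_num at h1 h2 h3 hs0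
  exact ⟨h1 (by nlinarith), h2 (by nlinarith), h3 (by nlinarith)⟩

/-- For `n = 1` and `m < 0`, positivity of the Riley polynomial at `y = 2` suffices. -/
lemma exists_root_one_of_neg {m : ℤ} {x : ℝ} (hm : m < 0) (hx : x ^ 2 < 4)
    (h : 0 < 1 - (m + 3) * (4 - x ^ 2) + (m + 1) * (4 - x ^ 2) ^ 2) :
    ∃ y : ℝ, 2 < y ∧ RileyR chebS 1 m x y = 0 := by
  have h1 := (exists_root_of_neg hm hx 1 le_rfl).1
  rw [Nat.cast_one, (RileyR_two 1 _ _).1] at h1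
  norm_num at h1
  exact h1 (by linarith)

/-- For nonzero integers `m`, `n` and a positive integer `r`, the equation
`R_{n,m}(2 cos(π/r), y) = 0` has a real solution `y > 2` in the cases:
(1) `r ≥ 3` when `n ≥ 3` or `n ≤ -4`; (2) `r ≥ 4` when `n = 2` or `n = -3`;
(3) `r ≥ 5` when `n = 1, m ∈ {1,2}` or `n = -2, m = -1`;
(4) `r ≥ 6` when `n = 1, m ≥ 3` or `n = -2, m ≤ -2`;
(5) `r ≥ 7` when `n = 1, m ≤ -4` or `n = -2, m ≥ 6`;
(6) `r ≥ 8` when `n = 1, m ∈ {-2,-3}`; (7) `r ≥ 9` when `n = 1, m = -1`. -/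
theorem riley_root_all_cases
    (S : ℤ → ℝ → ℝ)
    (hS0 : ∀ z : ℝ, S 0 z = 1)
    (hS1 : ∀ z : ℝ, S 1 z = z)
    (hSrec : ∀ (k : ℤ) (z : ℝ), S k z = z * S (k - 1) z - S (k - 2) z)
    (n m : ℤ) (hn : n ≠ 0) (hm : m ≠ 0) (r : ℕ) (hr : 1 ≤ r) :
    (3 ≤ r → (3 ≤ n ∨ n ≤ -4) →
      ∃ y : ℝ, 2 < y ∧ RileyR S n m (2 * Real.cos (π / r)) y = 0) ∧
    (4 ≤ r → (n = 2 ∨ n = -3) →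
      ∃ y : ℝ, 2 < y ∧ RileyR S n m (2 * Real.cos (π / r)) y = 0) ∧
    (5 ≤ r → ((n = 1 ∧ (m = 1 ∨ m = 2)) ∨ (n = -2 ∧ m = -1)) →
      ∃ y : ℝ, 2 < y ∧ RileyR S n m (2 * Real.cos (π / r)) y = 0) ∧
    (6 ≤ r → ((n = 1 ∧ 3 ≤ m) ∨ (n = -2 ∧ m ≤ -2)) →
      ∃ y : ℝ, 2 < y ∧ RileyR S n m (2 * Real.cos (π / r)) y = 0) ∧
    (7 ≤ r → ((n = 1 ∧ m ≤ -4) ∨ (n = -2 ∧ 6 ≤ m)) →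
      ∃ y : ℝ, 2 < y ∧ RileyR S n m (2 * Real.cos (π / r)) y = 0) ∧
    (8 ≤ r → (n = 1 ∧ (m = -2 ∨ m = -3)) →
      ∃ y : ℝ, 2 < y ∧ RileyR S n m (2 * Real.cos (π / r)) y = 0) ∧
    (9 ≤ r → (n = 1 ∧ m = -1) →
      ∃ y : ℝ, 2 < y ∧ RileyR S n m (2 * Real.cos (π / r)) y = 0) := by
  obtain rfl := eq_chebS S hS0 hS1 hSrec
  have hx (h : 2 ≤ r) : (2 * cos (π / r)) ^ 2 < 4 := two_mul_cos_sq_lt h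
  refine ⟨fun h3 h => ?_, fun h4 h => ?_, fun h5 h => ?_, fun h6 h => ?_, fun h7 h => ?_,
    fun h8 h => ?_, fun h9 h => ?_⟩
  · rcases h with h | h
    · obtain ⟨N, rfl⟩ : ∃ N : ℕ, n = N := ⟨n.toNat, by omega⟩
      exact (exists_root_of_three_le hm (by omega) h3).1
    · obtain ⟨N, rfl⟩ : ∃ N : ℕ, n = -1 - N := ⟨(-1 - n).toNat, by omega⟩
      exact (exists_root_of_three_le hm (by omega) h3).2
  · rcases h with rfl | rfl
    · exact (exists_root_of_eq_two hm h4).1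
    · exact (exists_root_of_eq_two hm h4).2
  · obtain rfl | h6 : r = 5 ∨ 6 ≤ r := by omega
    · obtain ⟨rfl, rfl | rfl⟩ | ⟨rfl, rfl⟩ := h
      · exact exists_root_of_eq_five.1
      · exact exists_root_of_eq_five.2.1
      · exact exists_root_of_eq_five.2.2
    · rcases h with ⟨rfl, h⟩ | ⟨rfl, h⟩
      · exact (exists_root_of_six_le h6).1 (by omega)
      · exact (exists_root_of_six_le h6).2 (by omega)
  · rcases h with ⟨rfl, h⟩ | ⟨rfl, h⟩
    · exact (exists_root_of_six_le h6).1 (by omega)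
    · exact (exists_root_of_six_le h6).2 (by omega)
  · have h7' := four_sub_sq_lt_of_seven_le h7
    rcases h with ⟨rfl, h⟩ | ⟨rfl, h⟩
    · refine exists_root_one_of_neg (by omega) (hx (by omega)) ?_
      have hm' : (m : ℝ) ≤ -4 := by exact_mod_cast h
      have hx' := hx (by omega)
      set v := 4 - (2 * cos (π / r)) ^ 2
      have hv : 0 < v := by linarith
      nlinarith [mul_nonneg (mul_nonneg hv.le (show 0 ≤ 1 - v by linarith))
        (show (0 : ℝ) ≤ -4 - m by linarith)]
    · exact exists_root_neg_two_of_six_le h (hx (by omega)) h7'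
  · have h8' := four_sub_sq_lt_of_eight_le h8
    have hx' := hx (by omega)
    obtain ⟨rfl, rfl | rfl⟩ := h
    all_goals
      refine exists_root_one_of_neg (by norm_num) hx' ?_
      push_cast
      nlinarith
  · have h9' := four_sub_sq_lt_of_nine_le h9
    obtain ⟨rfl, rfl⟩ := h
    refine exists_root_one_of_neg (by norm_num) (hx (by omega)) ?_
    push_cast
    linarith
end
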